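/- arXiv:2305.18833 — 3 statements merged into one kernel-verified Lean document; each statement's English description precedes it below -/
import Mathlib

section
/- (Difference relation from (S₂).) For every integer n ≥ 1 and every index 1 ≤ j ≤ N: (t_j − α_n)·(r_{n+1,j} − r_{n,j}) = β_{n+1}·R_{n+1,j} − β_n·R_{n−1,j}. -/
open MeasureTheory Polynomial

/-- The linear functional `q ↦ ∫ q w` for a weight `w` with finite moments. -/
noncomputable def momentFunctional (w : ℝ → ℝ)
    (hw : ∀ q : ℝ[X], Integrable fun x => q.eval x * w x) : ℝ[X] →ₗ[ℝ] ℝ where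
  toFun q := ∫ x, q.eval x * w x
  map_add' p q := by
    simp only [eval_add, add_mul]
    exact integral_add (hw p) (hw q)
  map_smul' c q := by
    simp only [eval_smul, smul_eq_mul, mul_assoc, RingHom.id_apply]
    exact integral_const_mul _ _

lemma momentFunctional_apply {w : ℝ → ℝ}
    (hw : ∀ q : ℝ[X], Integrable fun x => q.eval x * w x) (q : ℝ[X]) :
    momentFunctional w hw q = ∫ x, q.eval x * w x := rfl

section OrthogonalPolynomials

variable {P : ℕ → ℝ[X]} {L : ℝ[X] →ₗ[ℝ] ℝ}

lemma degree_sub_C_coeff_mul_lt {p : ℝ[X]} (hp : p.Monic) {n : ℕ} (hn : p.natDegree = n)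
    {q : ℝ[X]} (hq : q.degree < (n + 1 : ℕ)) : (q - C (q.coeff n) * p).degree < n := by
  rw [degree_lt_iff_coeff_zero] at hq ⊢
  intro k hk
  rcases hk.eq_or_lt with rfl | hk
  · have : p.coeff n = 1 := by rw [← hn]; exact hp
    simp [this]
  · simp [hq k hk, coeff_eq_zero_of_natDegree_lt (hn.trans_lt hk)]

lemma orthogonal_of_degree_lt (hmonic : ∀ n, (P n).Monic) (hdeg : ∀ n, (P n).natDegree = n)
    (horth : ∀ m n, m ≠ n → L (P m * P n) = 0) {m n : ℕ} (hnm : n ≤ m) {q : ℝ[X]}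
    (hq : q.degree < n) : L (P m * q) = 0 := by
  induction n generalizing q with
  | zero =>
    have : q = 0 := by simpa [← degree_eq_bot, Nat.WithBot.lt_zero_iff] using hq
    simp [this]
  | succ n ih =>
    have hsplit : P m * q = P m * (q - C (q.coeff n) * P n) + q.coeff n • (P m * P n) := by
      rw [smul_eq_C_mul]; ring
    rw [hsplit, map_add, map_smul, horth m n (by lia),
      ih (by lia) (degree_sub_C_coeff_mul_lt (hmonic n) (hdeg n) hq)]
    simp

lemma functional_mul_eq_coeff_mul (hmonic : ∀ n, (P n).Monic) (hdeg : ∀ n, (P n).natDegree = n)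
    (horth : ∀ m n, m ≠ n → L (P m * P n) = 0) {m : ℕ} {q : ℝ[X]}
    (hq : q.degree < (m + 1 : ℕ)) : L (P m * q) = q.coeff m * L (P m * P m) := by
  have hsplit : P m * q = P m * (q - C (q.coeff m) * P m) + q.coeff m • (P m * P m) := by
    rw [smul_eq_C_mul]; ring
  rw [hsplit, map_add, map_smul, orthogonal_of_degree_lt hmonic hdeg horth le_rfl
    (degree_sub_C_coeff_mul_lt (hmonic m) (hdeg m) hq), zero_add, smul_eq_mul]

lemma eq_zero_of_functional_mul_eq_zero (hmonic : ∀ n, (P n).Monic)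
    (hdeg : ∀ n, (P n).natDegree = n) (horth : ∀ m n, m ≠ n → L (P m * P n) = 0)
    (hne : ∀ n, L (P n * P n) ≠ 0) {n : ℕ} {q : ℝ[X]} (hq : q.degree < n)
    (h0 : ∀ k < n, L (P k * q) = 0) : q = 0 := by
  by_contra hq0
  have hlt : q.natDegree < n := (natDegree_lt_iff_degree_lt hq0).2 hq
  have := functional_mul_eq_coeff_mul (m := q.natDegree) hmonic hdeg horth
    ((natDegree_lt_iff_degree_lt hq0).1 (Nat.lt_succ_self _))
  rw [h0 _ hlt] at this
  exact mul_ne_zero (leadingCoeff_ne_zero.2 hq0) (hne _) this.symm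

lemma three_term_recurrence (hmonic : ∀ n, (P n).Monic) (hdeg : ∀ n, (P n).natDegree = n)
    (horth : ∀ m n, m ≠ n → L (P m * P n) = 0) (hne : ∀ n, L (P n * P n) ≠ 0)
    {n : ℕ} {a b : ℝ} (ha : a * L (P (n + 1) * P (n + 1)) = L (X * (P (n + 1) * P (n + 1))))
    (hb : b * L (P n * P n) = L (P (n + 1) * P (n + 1))) :
    X * P (n + 1) = P (n + 2) + C a * P (n + 1) + C b * P n := by
  have hcoeff (m) : (P m).coeff m = 1 := by
    have := hmonic m
    rwa [Monic, leadingCoeff, hdeg] at this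
  have hcoeff' {m k} (hk : m < k) : (P m).coeff k = 0 :=
    coeff_eq_zero_of_natDegree_lt ((hdeg m).trans_lt hk)
  rw [← sub_eq_zero]
  refine eq_zero_of_functional_mul_eq_zero (n := n + 2) hmonic hdeg horth hne ?_ fun k hk => ?_
  · rw [degree_lt_iff_coeff_zero]
    rintro (_ | k) hk
    · lia
    rcases hk.eq_or_lt with h | hk
    · obtain rfl : k = n + 1 := by lia
      simp [coeff_X_mul, hcoeff, hcoeff']
    · simp [coeff_X_mul, hcoeff' (show n + 1 < k by lia), hcoeff' (show n + 2 < k + 1 by lia),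
        hcoeff' (show n + 1 < k + 1 by lia), hcoeff' (show n < k + 1 by lia)]
  · have hsplit : P k * (X * P (n + 1) - (P (n + 2) + C a * P (n + 1) + C b * P n)) =
        P (n + 1) * (X * P k) - P k * P (n + 2) - a • (P k * P (n + 1)) - b • (P k * P n) := by
      rw [smul_eq_C_mul, smul_eq_C_mul]; ring
    simp only [hsplit, map_sub, map_smul, smul_eq_mul]
    rw [horth k (n + 2) (by lia)]
    rcases (show k = n + 1 ∨ k ≤ n by lia) with rfl | hk'
    · rw [horth (n + 1) n (by lia), show P (n + 1) * (X * P (n + 1)) =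
        X * (P (n + 1) * P (n + 1)) by ring]
      linarith
    · rw [horth k (n + 1) (by lia), functional_mul_eq_coeff_mul hmonic hdeg horth, coeff_X_mul]
      · rcases hk'.eq_or_lt with rfl | hlt
        · rw [hcoeff]; linarith
        · rw [hcoeff' hlt, horth k n hlt.ne]; ring
      · rw [degree_lt_iff_coeff_zero]
        rintro (_ | i) hi
        · lia
        · rw [coeff_X_mul, hcoeff' (by lia)]

end OrthogonalPolynomials

section Integrability

lemma integrable_eval_mul_exp_neg_sq (q : ℝ[X]) :
    Integrable fun x : ℝ => q.eval x * Real.exp (-x ^ 2) := by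
  induction q using Polynomial.induction_on' with
  | add p q hp hq =>
    simp only [eval_add, add_mul]
    exact hp.add hq
  | monomial n a =>
    have := (integrable_rpow_mul_exp_neg_mul_sq one_pos
      (show (-1 : ℝ) < n by linarith [n.cast_nonneg (α := ℝ)])).const_mul a
    simpa [mul_assoc] using this

lemma exists_polynomial_abs_rpow_le (t : ℝ) {g : ℝ} (hg : 0 < g) :
    ∃ q : ℝ[X], ∀ x : ℝ, |x - t| ^ g ≤ q.eval x := by
  refine ⟨(1 + (X - C t) ^ 2) ^ ⌈g⌉₊, fun x => ?_⟩
  have h1 : |x - t| ≤ 1 + (x - t) ^ 2 := by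
    nlinarith [sq_abs (x - t), sq_nonneg (|x - t| - 1), sq_nonneg (x - t)]
  have h2 : (1 : ℝ) ≤ 1 + (x - t) ^ 2 := by nlinarith [sq_nonneg (x - t)]
  calc |x - t| ^ g ≤ (1 + (x - t) ^ 2) ^ g := Real.rpow_le_rpow (abs_nonneg _) h1 hg.le
    _ ≤ (1 + (x - t) ^ 2) ^ (⌈g⌉₊ : ℝ) := Real.rpow_le_rpow_of_exponent_le h2 (Nat.le_ceil g)
    _ = _ := by simp [Real.rpow_natCast]

variable {ι : Type*} (s : Finset ι) {t γ : ι → ℝ}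

lemma continuous_exp_neg_sq_mul_prod (hγ : ∀ j, 0 < γ j) :
    Continuous fun x : ℝ => Real.exp (-x ^ 2) * ∏ j ∈ s, |x - t j| ^ γ j := by
  refine Continuous.mul (by fun_prop) (continuous_finsetProd _ fun j _ => ?_)
  exact (continuous_abs.comp (continuous_sub_right _)).rpow_const fun _ => Or.inr (hγ j).le

lemma integrable_eval_mul_exp_neg_sq_mul_prod (hγ : ∀ j, 0 < γ j) (q : ℝ[X]) :
    Integrable fun x : ℝ => q.eval x * (Real.exp (-x ^ 2) * ∏ j ∈ s, |x - t j| ^ γ j) := by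
  choose Q hQ using fun j => exists_polynomial_abs_rpow_le (t j) (hγ j)
  refine (integrable_eval_mul_exp_neg_sq (q * ∏ j ∈ s, Q j)).mono
    (q.continuous.mul (continuous_exp_neg_sq_mul_prod s hγ)).aestronglyMeasurable
    (ae_of_all _ fun x => ?_)
  have hle : ∏ j ∈ s, |x - t j| ^ γ j ≤ ∏ j ∈ s, (Q j).eval x :=
    Finset.prod_le_prod (fun _ _ => by positivity) fun j _ => hQ j x
  have h0 : 0 ≤ ∏ j ∈ s, |x - t j| ^ γ j := Finset.prod_nonneg fun _ _ => by positivity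
  rw [eval_mul, eval_prod, mul_assoc, mul_comm _ (Real.exp _)]
  simp only [norm_mul]
  rw [Real.norm_of_nonneg h0, Real.norm_of_nonneg (h0.trans hle)]
  gcongr

lemma locallyIntegrable_abs_rpow {g : ℝ} (hg : 0 < g) :
    LocallyIntegrable fun x : ℝ => |x| ^ (g - 1) := by
  refine locallyIntegrable_of_norm_le_rpow (C := 1) (α := 1 - g) (by simp) (by simpa)
    (ae_of_all _ fun x => ?_) (Measurable.aestronglyMeasurable (by fun_prop))
  rw [Real.norm_of_nonneg (by positivity), one_mul, neg_sub, Real.norm_eq_abs]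

lemma integrableOn_abs_sub_rpow (t : ℝ) {g : ℝ} (hg : 0 < g) :
    IntegrableOn (fun x : ℝ => |x - t| ^ (g - 1)) (Set.Icc (t - 1) (t + 1)) := by
  have h := (locallyIntegrable_abs_rpow hg).integrableOn_isCompact
    (isCompact_Icc (a := (-1 : ℝ)) (b := 1))
  have h' := ((measurePreserving_sub_right volume t).integrableOn_comp_preimage
    (measurableEmbedding_subRight t)).2 h
  rw [Set.preimage_sub_const_Icc, neg_add_eq_sub, add_comm 1] at h'
  exact h'

lemma integrable_eval_mul_exp_neg_sq_mul_prod_div (hγ : ∀ j, 0 < γ j) {j : ι} (hj : j ∈ s)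
    (q : ℝ[X]) :
    Integrable fun x : ℝ =>
      q.eval x * ((Real.exp (-x ^ 2) * ∏ i ∈ s, |x - t i| ^ γ i) / (x - t j)) := by
  classical
  have hcont := q.continuous.mul (continuous_exp_neg_sq_mul_prod (t := t) s hγ)
  have hmeas : AEStronglyMeasurable (fun x : ℝ =>
      q.eval x * ((Real.exp (-x ^ 2) * ∏ i ∈ s, |x - t i| ^ γ i) / (x - t j))) := by
    refine Measurable.aestronglyMeasurable ?_
    simp only [← mul_div_assoc]
    exact hcont.measurable.div (by fun_prop)
  rw [← integrableOn_univ, ← Set.union_compl_self (Set.Icc (t j - 1) (t j + 1))]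
  refine IntegrableOn.union ?_ ?_
  · have hint := (integrableOn_abs_sub_rpow (t j) (hγ j)).continuousOn_mul
      (q.continuous.mul (continuous_exp_neg_sq_mul_prod (t := t) (s.erase j) hγ)).continuousOn
      isCompact_Icc
    refine Integrable.mono hint hmeas.restrict (ae_of_all _ fun x => ?_)
    by_cases hx : x = t j
    · simp only [hx, sub_self, div_zero, mul_zero, norm_zero]
      positivity
    · refine le_of_eq ?_
      have hpos : 0 < |x - t j| := abs_pos.2 (sub_ne_zero.2 hx)
      rw [← Finset.mul_prod_erase s _ hj]
      simp only [norm_mul, norm_div, Real.norm_eq_abs, abs_of_nonneg (Real.rpow_nonneg hpos.le _),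
        Real.rpow_sub_one hpos.ne', Pi.mul_apply, abs_abs]
      ring
  · refine Integrable.mono
      (integrable_eval_mul_exp_neg_sq_mul_prod (t := t) s hγ q).integrableOn hmeas.restrict ?_
    filter_upwards [ae_restrict_mem measurableSet_Icc.compl] with x hx
    have h1 : 1 ≤ ‖x - t j‖ := by
      by_contra! hlt
      rw [Real.norm_eq_abs, abs_lt] at hlt
      exact hx ⟨by linarith, by linarith⟩
    rw [← mul_div_assoc, norm_div]
    exact div_le_self (norm_nonneg _) h1

end Integrability

theorem difference_relation_S2
    (N : ℕ) (hN : 1 ≤ N)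
    (t γ : Fin N → ℝ) (ht : Function.Injective t) (hγ : ∀ j, 0 < γ j)
    (w : ℝ → ℝ) (hw : ∀ x : ℝ, w x = Real.exp (-x ^ 2) * ∏ j, |x - t j| ^ γ j)
    (P : ℕ → Polynomial ℝ)
    (hPmonic : ∀ n, (P n).Monic) (hPdeg : ∀ n, (P n).natDegree = n)
    (horth : ∀ m n, m ≠ n → ∫ x : ℝ, (P m).eval x * (P n).eval x * w x = 0)
    (h : ℕ → ℝ) (hh : ∀ n, h n = ∫ x : ℝ, ((P n).eval x) ^ 2 * w x)
    (hhpos : ∀ n, 0 < h n)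
    (β : ℕ → ℝ) (hβ0 : β 0 = 0) (hβ : ∀ n, β (n + 1) = h (n + 1) / h n)
    (α : ℕ → ℝ) (hα : ∀ n, α n = (∫ x : ℝ, x * ((P n).eval x) ^ 2 * w x) / h n)
    (R : ℕ → Fin N → ℝ)
    (hR : ∀ n j, R n j = γ j / h n * ∫ y : ℝ, ((P n).eval y) ^ 2 * w y / (y - t j))
    (r : ℕ → Fin N → ℝ) (hr0 : ∀ j, r 0 j = 0)
    (hr : ∀ n j, r (n + 1) j = γ j / h n * ∫ y : ℝ, (P (n + 1)).eval y * (P n).eval y * w y / (y - t j))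
    (n : ℕ) (hn : 1 ≤ n) (j : Fin N) :
    (t j - α n) * (r (n + 1) j - r n j) = β (n + 1) * R (n + 1) j - β n * R (n - 1) j := by
  have hw' : w = fun x => Real.exp (-x ^ 2) * ∏ j, |x - t j| ^ γ j := funext hw
  have hint (q : ℝ[X]) : Integrable fun x => q.eval x * w x := by
    simpa only [hw'] using integrable_eval_mul_exp_neg_sq_mul_prod Finset.univ hγ q
  have hint' (q : ℝ[X]) : Integrable fun x => q.eval x * (w x / (x - t j)) := by
    simpa only [hw'] using
      integrable_eval_mul_exp_neg_sq_mul_prod_div Finset.univ hγ (Finset.mem_univ j) q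
  set L := momentFunctional w hint with hL
  set M := momentFunctional _ hint' with hM
  have hLP (m n) : L (P m * P n) = ∫ x, (P m).eval x * (P n).eval x * w x := by
    simp [hL, momentFunctional_apply]
  have hLh (n) : L (P n * P n) = h n := by rw [hLP, hh]; simp only [sq]
  have hLX (n) : L (X * (P n * P n)) = α n * h n := by
    rw [hα, div_mul_cancel₀ _ (hhpos n).ne']
    simp [hL, momentFunctional_apply, sq]
  have horth' (m n) (hmn : m ≠ n) : L (P m * P n) = 0 := (hLP m n).trans (horth m n hmn)
  have hMR (n) : R n j = γ j / h n * M (P n * P n) := by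
    simp [hR, hM, momentFunctional_apply, sq, mul_div_assoc]
  have hMr (n) : r (n + 1) j = γ j / h n * M (P (n + 1) * P n) := by
    simp [hr, hM, momentFunctional_apply, mul_div_assoc]
  have hwt : w (t j) = 0 := by
    rw [hw, Finset.prod_eq_zero (Finset.mem_univ j), mul_zero]
    simp [Real.zero_rpow (hγ j).ne']
  have hML (q : ℝ[X]) : M (X * q) = t j * M q + L q := by
    have hfactor : M ((X - C (t j)) * q) = L q := by
      rw [hL, hM, momentFunctional_apply, momentFunctional_apply]
      refine integral_congr_ae (ae_of_all _ fun x => ?_)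
      by_cases hx : x = t j
      · simp [hx, hwt]
      · have := sub_ne_zero.2 hx
        simp only [eval_mul, eval_sub, eval_X, eval_C]
        field_simp
    rw [sub_mul, map_sub, ← smul_eq_C_mul, map_smul, smul_eq_mul] at hfactor
    linarith
  obtain ⟨k, rfl⟩ : ∃ k, n = k + 1 := ⟨n - 1, by lia⟩
  have hrec := three_term_recurrence (n := k) (a := α (k + 1)) (b := β (k + 1)) (L := L)
    hPmonic hPdeg horth' (fun n => by rw [hLh]; exact (hhpos n).ne') (by rw [hLh, hLX])
    (by rw [hLh, hLh, hβ, div_mul_cancel₀ _ (hhpos k).ne'])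
  have hpoly : X * (P (k + 2) * P (k + 1) - β (k + 1) • (P (k + 1) * P k)) =
      α (k + 1) • (P (k + 2) * P (k + 1) - β (k + 1) • (P (k + 1) * P k)) +
        (P (k + 2) * P (k + 2) - β (k + 1) ^ 2 • (P k * P k)) := by
    simp only [smul_eq_C_mul, map_pow]
    linear_combination (P (k + 2) - C (β (k + 1)) * P k) * hrec
  have key := congrArg M hpoly
  rw [hML] at key
  simp only [map_sub, map_add, map_smul, smul_eq_mul, horth' (k + 2) (k + 1) (by lia),
    horth' (k + 1) k (by lia)] at key
  have h0 := (hhpos k).ne'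
  have h1 := (hhpos (k + 1)).ne'
  have h2 := (hhpos (k + 2)).ne'
  rw [hMr, hMr, hMR, Nat.add_sub_cancel, hMR, hβ, hβ]
  rw [hβ] at key
  simp only [add_assoc, Nat.reduceAdd] at key ⊢
  field_simp at key ⊢
  linear_combination γ j * key
end

section
/- (Summed product identity, equation (3.13) of the paper.) For every integer n ≥ 1 and every index 1 ≤ j ≤ N: r_{n,j}² − γ_j·r_{n,j} = β_n·R_{n,j}·R_{n−1,j}. -/
open MeasureTheory Polynomial

/-- `f` grows at most exponentially: `|f x| ≤ C * exp (c * |x|)` for all `x`. -/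
def HasExpGrowth (f : ℝ → ℝ) : Prop :=
  ∃ C c : ℝ, ∀ x, |f x| ≤ C * Real.exp (c * |x|)

namespace HasExpGrowth

lemma mul {f g : ℝ → ℝ} (hf : HasExpGrowth f) (hg : HasExpGrowth g) :
    HasExpGrowth fun x => f x * g x := by
  obtain ⟨C, c, hC⟩ := hf
  obtain ⟨D, d, hD⟩ := hg
  refine ⟨C * D, c + d, fun x => ?_⟩
  calc |f x * g x| = |f x| * |g x| := abs_mul _ _
    _ ≤ (C * Real.exp (c * |x|)) * (D * Real.exp (d * |x|)) :=
        mul_le_mul (hC x) (hD x) (abs_nonneg _) ((abs_nonneg _).trans (hC x))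
    _ = C * D * Real.exp ((c + d) * |x|) := by rw [add_mul, Real.exp_add]; ring

lemma add {f g : ℝ → ℝ} (hf : HasExpGrowth f) (hg : HasExpGrowth g) :
    HasExpGrowth fun x => f x + g x := by
  obtain ⟨C, c, hC⟩ := hf
  obtain ⟨D, d, hD⟩ := hg
  refine ⟨|C| + |D|, max c d, fun x => ?_⟩
  have h₁ : C * Real.exp (c * |x|) ≤ |C| * Real.exp (max c d * |x|) := by
    gcongr
    exacts [le_abs_self C, le_max_left c d]
  have h₂ : D * Real.exp (d * |x|) ≤ |D| * Real.exp (max c d * |x|) := by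
    gcongr
    exacts [le_abs_self D, le_max_right c d]
  linarith [abs_add_le (f x) (g x), hC x, hD x]

lemma const (a : ℝ) : HasExpGrowth fun _ => a :=
  ⟨|a|, 0, fun x => by simp⟩

lemma id : HasExpGrowth fun x => x :=
  ⟨1, 1, fun x => by linarith [Real.add_one_le_exp (1 * |x|)]⟩

lemma abs_sub_rpow (t : ℝ) {γ : ℝ} (hγ : 0 ≤ γ) : HasExpGrowth fun x => |x - t| ^ γ := by
  refine ⟨Real.exp (γ * |t|), γ, fun x => ?_⟩
  have h : |x - t| ≤ Real.exp (|x| + |t|) := by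
    linarith [Real.add_one_le_exp (|x| + |t|), abs_sub x t]
  rw [abs_of_nonneg (by positivity)]
  calc |x - t| ^ γ ≤ Real.exp (|x| + |t|) ^ γ := by gcongr
    _ = Real.exp (γ * |t|) * Real.exp (γ * |x|) := by
        rw [← Real.exp_mul, ← Real.exp_add]; ring_nf

lemma prod {ι : Type*} (s : Finset ι) {f : ι → ℝ → ℝ} (hf : ∀ i, HasExpGrowth (f i)) :
    HasExpGrowth fun x => ∏ i ∈ s, f i x := by
  classical
  induction s using Finset.induction_on with
  | empty => simpa using const 1
  | insert i s hi ih => simpa only [Finset.prod_insert hi] using (hf i).mul ih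

lemma polynomial (p : ℝ[X]) : HasExpGrowth fun x => p.eval x := by
  induction p using Polynomial.induction_on with
  | C a => simpa using const a
  | add p q hp hq => simpa using hp.add hq
  | monomial n a h => simpa [pow_succ, mul_assoc] using h.mul id

lemma exp_neg_sq_mul_le {f : ℝ → ℝ} (hf : HasExpGrowth f) :
    ∃ C : ℝ, ∀ x, |Real.exp (-x ^ 2) * f x| ≤ C * Real.exp (-(1 / 2) * x ^ 2) := by
  obtain ⟨C, c, hC⟩ := hf
  refine ⟨|C| * Real.exp (c ^ 2 / 2), fun x => ?_⟩
  calc |Real.exp (-x ^ 2) * f x| = Real.exp (-x ^ 2) * |f x| := by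
        rw [abs_mul, Real.abs_exp]
    _ ≤ Real.exp (-x ^ 2) * (|C| * Real.exp (c * |x|)) := by
        gcongr
        exact (hC x).trans (by gcongr; exact le_abs_self C)
    _ = |C| * Real.exp (-x ^ 2 + c * |x|) := by rw [Real.exp_add]; ring
    _ ≤ |C| * Real.exp (c ^ 2 / 2 + -(1 / 2) * x ^ 2) := by
        refine mul_le_mul_of_nonneg_left (Real.exp_le_exp.2 ?_) (abs_nonneg C)
        nlinarith [sq_nonneg (c - |x|), sq_abs x]
    _ = |C| * Real.exp (c ^ 2 / 2) * Real.exp (-(1 / 2) * x ^ 2) := by rw [Real.exp_add]; ring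

lemma integrable_exp_neg_sq_mul {f : ℝ → ℝ} (hf : HasExpGrowth f) (hf' : Continuous f) :
    Integrable fun x => Real.exp (-x ^ 2) * f x := by
  obtain ⟨C, hC⟩ := hf.exp_neg_sq_mul_le
  exact ((integrable_exp_neg_mul_sq (by norm_num : (0 : ℝ) < 1 / 2)).const_mul C).mono'
    (by fun_prop) (.of_forall hC)

/-- An integrable singularity `|x - t| ^ γ / (x - t)` preserves integrability against the Gaussian
weight. -/
lemma integrable_exp_neg_sq_mul_singular {f : ℝ → ℝ} (hf : HasExpGrowth f) (hf' : Continuous f)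
    (t : ℝ) {γ : ℝ} (hγ : 0 < γ) :
    Integrable fun x => Real.exp (-x ^ 2) * f x * (|x - t| ^ γ / (x - t)) := by
  have hloc : LocallyIntegrable fun x : ℝ => |x| ^ γ / x := by
    refine locallyIntegrable_of_norm_le_rpow (C := 1) (α := 1 - γ) (by simp) (by simpa) ?_
      (by fun_prop : Measurable fun x : ℝ => |x| ^ γ / x).aestronglyMeasurable
    refine .of_forall fun x => ?_
    rcases eq_or_ne x 0 with rfl | hx
    · simp [Real.zero_rpow_nonneg]
    · rw [norm_div, Real.norm_eq_abs, Real.norm_eq_abs, abs_of_nonneg (by positivity), one_mul,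
        neg_sub, Real.rpow_sub_one (abs_ne_zero.2 hx)]
  have hball : Integrable ((Metric.closedBall (0 : ℝ) 1).indicator fun x => |x| ^ γ / x) :=
    (integrable_indicator_iff measurableSet_closedBall).2
      (hloc.integrableOn_isCompact (isCompact_closedBall 0 1))
  obtain ⟨C, hC⟩ := hf.exp_neg_sq_mul_le
  have hfar := (hf.mul (abs_sub_rpow t hγ.le)).integrable_exp_neg_sq_mul
    (hf'.mul ((by fun_prop : Continuous fun x : ℝ => |x - t|).rpow_const fun _ => .inr hγ.le))
  have hmeas : Measurable fun x => Real.exp (-x ^ 2) * f x * (|x - t| ^ γ / (x - t)) := by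
    have := hf'.measurable
    fun_prop
  refine (((hball.comp_sub_right t).norm.const_mul |C|).add hfar.norm).mono'
    hmeas.aestronglyMeasurable (.of_forall fun x => ?_)
  have hCx : |Real.exp (-x ^ 2) * f x| ≤ |C| := by
    refine (hC x).trans ((mul_le_mul_of_nonneg_right (le_abs_self C) (Real.exp_nonneg _)).trans
      (mul_le_of_le_one_right (abs_nonneg C) (Real.exp_le_one_iff.2 ?_)))
    nlinarith [sq_nonneg x]
  simp only [Pi.add_apply, Real.norm_eq_abs]
  by_cases hx : |x - t| ≤ 1
  · rw [Set.indicator_of_mem (by simpa using hx), abs_mul]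
    exact le_add_of_le_of_nonneg (by gcongr) (abs_nonneg _)
  · rw [Set.indicator_of_notMem (by simpa using hx), ← mul_assoc, abs_mul, abs_mul _ (|x - t| ^ γ),
      abs_div]
    simp only [abs_zero, mul_zero, zero_add]
    gcongr
    exact div_le_self (abs_nonneg _) (not_le.1 hx).le

end HasExpGrowth

lemma integral_mul_eq_zero_of_degree_lt {w : ℝ → ℝ} {P : ℕ → ℝ[X]}
    (hint : ∀ f : ℝ[X], Integrable fun x => f.eval x * w x)
    (hmonic : ∀ n, (P n).Monic) (hdeg : ∀ n, (P n).natDegree = n)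
    (horth : ∀ m n, m ≠ n → ∫ x : ℝ, (P m).eval x * (P n).eval x * w x = 0)
    {n d : ℕ} (hd : d ≤ n) {q : ℝ[X]} (hq : q.degree < d) :
    ∫ x : ℝ, (P n * q).eval x * w x = 0 := by
  induction d generalizing q with
  | zero =>
    have : q = 0 := by simpa using hq
    simp [this]
  | succ d ih =>
    have hred : (q - C (q.coeff d) * P d).degree < d := by
      rw [degree_lt_iff_coeff_zero] at hq ⊢
      intro m hm
      rcases hm.eq_or_lt with rfl | hm
      · have := (hmonic d).coeff_natDegree
        rw [hdeg] at this
        simp [this]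
      · simp [hq m hm, coeff_eq_zero_of_natDegree_lt ((hdeg d).trans_lt hm)]
    have hsplit : (fun x => (P n * q).eval x * w x) = fun x =>
        (P n * (q - C (q.coeff d) * P d)).eval x * w x +
          q.coeff d * ((P n * P d).eval x * w x) := by
      funext x
      simp only [eval_mul, eval_sub, eval_C]
      ring
    rw [hsplit, integral_add (hint _) ((hint _).const_mul _), ih (by omega) hred,
      integral_const_mul]
    simp [eval_mul, horth n d (by omega)]

lemma integral_mul_eq_of_monic {w : ℝ → ℝ} {P : ℕ → ℝ[X]}
    (hint : ∀ f : ℝ[X], Integrable fun x => f.eval x * w x)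
    (hmonic : ∀ n, (P n).Monic) (hdeg : ∀ n, (P n).natDegree = n)
    (horth : ∀ m n, m ≠ n → ∫ x : ℝ, (P m).eval x * (P n).eval x * w x = 0)
    {n : ℕ} {q : ℝ[X]} (hq : q.Monic) (hqn : q.natDegree = n) :
    ∫ x : ℝ, (P n * q).eval x * w x = ∫ x : ℝ, (P n).eval x ^ 2 * w x := by
  have hlt : (q - P n).degree < n := by
    have hdegq : q.degree = n := by rw [degree_eq_natDegree hq.ne_zero, hqn]
    have hdegP : (P n).degree = n := by rw [degree_eq_natDegree (hmonic n).ne_zero, hdeg]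
    rw [← hdegq]
    exact degree_sub_lt_left (hdegq.trans hdegP.symm) hq.ne_zero
      (hq.leadingCoeff.trans (hmonic n).leadingCoeff.symm)
  have hsplit : (fun x => (P n * q).eval x * w x) = fun x =>
      (P n * (q - P n)).eval x * w x + (P n * P n).eval x * w x := by
    funext x
    simp only [eval_mul, eval_sub]
    ring
  rw [hsplit, integral_add (hint _) (hint _),
    integral_mul_eq_zero_of_degree_lt hint hmonic hdeg horth le_rfl hlt, zero_add]
  simp only [eval_mul, sq]

/-- Splitting off the value of `g` at a zero `t` of the weight in a singular integral. -/
lemma integral_mul_div_sub {w : ℝ → ℝ} {t : ℝ}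
    (hint : ∀ f : ℝ[X], Integrable fun x => f.eval x * w x)
    (hsing : ∀ f : ℝ[X], Integrable fun x => f.eval x * w x / (x - t))
    (hwt : w t = 0) (f g : ℝ[X]) :
    ∫ x : ℝ, f.eval x * g.eval x * w x / (x - t) =
      (∫ x : ℝ, (f * (g /ₘ (X - C t))).eval x * w x) +
        g.eval t * ∫ x : ℝ, f.eval x * w x / (x - t) := by
  rw [← integral_const_mul, ← integral_add (hint _) ((hsing f).const_mul _)]
  congr 1
  funext x
  rcases eq_or_ne x t with rfl | hx
  · simp [hwt]
  · have hg := congrArg (eval x) (modByMonic_add_div g (X - C t))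
    rw [modByMonic_X_sub_C_eq_C_eval] at hg
    simp only [eval_add, eval_mul, eval_sub, eval_X, eval_C] at hg
    rw [← hg, eval_mul]
    have := sub_ne_zero.2 hx
    field_simp
    ring

theorem summed_product_identity
    (N : ℕ) (hN : 1 ≤ N)
    (t γ : Fin N → ℝ) (ht : Function.Injective t) (hγ : ∀ j, 0 < γ j)
    (w : ℝ → ℝ) (hw : ∀ x : ℝ, w x = Real.exp (-x ^ 2) * ∏ j, |x - t j| ^ γ j)
    (P : ℕ → Polynomial ℝ)
    (hPmonic : ∀ n, (P n).Monic) (hPdeg : ∀ n, (P n).natDegree = n)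
    (horth : ∀ m n, m ≠ n → ∫ x : ℝ, (P m).eval x * (P n).eval x * w x = 0)
    (h : ℕ → ℝ) (hh : ∀ n, h n = ∫ x : ℝ, ((P n).eval x) ^ 2 * w x)
    (hhpos : ∀ n, 0 < h n)
    (β : ℕ → ℝ) (hβ0 : β 0 = 0) (hβ : ∀ n, β (n + 1) = h (n + 1) / h n)
    (α : ℕ → ℝ) (hα : ∀ n, α n = (∫ x : ℝ, x * ((P n).eval x) ^ 2 * w x) / h n)
    (R : ℕ → Fin N → ℝ)
    (hR : ∀ n j, R n j = γ j / h n * ∫ y : ℝ, ((P n).eval y) ^ 2 * w y / (y - t j))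
    (r : ℕ → Fin N → ℝ) (hr0 : ∀ j, r 0 j = 0)
    (hr : ∀ n j, r (n + 1) j = γ j / h n * ∫ y : ℝ, (P (n + 1)).eval y * (P n).eval y * w y / (y - t j))
    (n : ℕ) (hn : 1 ≤ n) (j : Fin N) :
    (r n j) ^ 2 - γ j * r n j = β n * R n j * R (n - 1) j := by
  obtain ⟨k, rfl⟩ : ∃ k, n = k + 1 := ⟨n - 1, by omega⟩
  have hint (f : ℝ[X]) : Integrable fun x => f.eval x * w x := by
    have hg : HasExpGrowth fun x => f.eval x * ∏ i, |x - t i| ^ γ i :=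
      (HasExpGrowth.polynomial f).mul (.prod _ fun i => .abs_sub_rpow (t i) (hγ i).le)
    refine (hg.integrable_exp_neg_sq_mul (f.continuous.mul (continuous_finsetProd _ fun i _ =>
      (by fun_prop : Continuous fun x : ℝ => |x - t i|).rpow_const
        fun _ => .inr (hγ i).le))).congr (.of_forall fun x => ?_)
    simp only [hw]
    ring
  have hsing (f : ℝ[X]) : Integrable fun x => f.eval x * w x / (x - t j) := by
    have hg : HasExpGrowth fun x => f.eval x * ∏ i ∈ Finset.univ.erase j, |x - t i| ^ γ i :=
      (HasExpGrowth.polynomial f).mul (.prod _ fun i => .abs_sub_rpow (t i) (hγ i).le)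
    refine (hg.integrable_exp_neg_sq_mul_singular (f.continuous.mul (continuous_finsetProd _
      fun i _ => (by fun_prop : Continuous fun x : ℝ => |x - t i|).rpow_const
        fun _ => .inr (hγ i).le)) (t j) (hγ j)).congr (.of_forall fun x => ?_)
    simp only [hw, ← Finset.mul_prod_erase Finset.univ _ (Finset.mem_univ j)]
    ring
  have hwt : w (t j) = 0 := by
    rw [hw, Finset.prod_eq_zero (Finset.mem_univ j) (by simp [(hγ j).ne']), mul_zero]
  have hsplit := integral_mul_div_sub hint hsing hwt
  have hquot (m : ℕ) : (P m /ₘ (X - C (t j))).degree < m :=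
    (degree_divByMonic_lt _ _ (hPmonic m).ne_zero (by simp)).trans_eq
      (by rw [degree_eq_natDegree (hPmonic m).ne_zero, hPdeg])
  have horth' {m d : ℕ} (hd : d ≤ m) :
      ∫ x : ℝ, (P m * (P d /ₘ (X - C (t j)))).eval x * w x = 0 :=
    integral_mul_eq_zero_of_degree_lt hint hPmonic hPdeg horth hd (hquot d)
  have hdiag (m : ℕ) := hsplit (P m) (P m)
  simp only [← sq, horth' le_rfl, zero_add] at hdiag
  have hcross₁ := hsplit (P (k + 1)) (P k)
  rw [horth' k.le_succ, zero_add] at hcross₁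
  have hcross₂ := hsplit (P k) (P (k + 1))
  rw [integral_mul_eq_of_monic hint hPmonic hPdeg horth, ← hh] at hcross₂
  rotate_left
  · rw [Monic, leadingCoeff_divByMonic_X_sub_C, hPmonic]
    rw [degree_eq_natDegree (hPmonic _).ne_zero, hPdeg]
    exact_mod_cast k.succ_ne_zero
  · rw [natDegree_divByMonic _ (monic_X_sub_C _), hPdeg, natDegree_X_sub_C, Nat.add_sub_cancel]
  simp only [mul_comm ((P k).eval _) ((P (k + 1)).eval _)] at hcross₂
  rw [Nat.add_sub_cancel, hr, hβ, hR, hR, hdiag, hdiag]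
  have h₀ := (hhpos k).ne'
  have h₁ := (hhpos (k + 1)).ne'
  set A := ∫ y : ℝ, (P (k + 1)).eval y * (P k).eval y * w y / (y - t j)
  set U := ∫ y : ℝ, (P (k + 1)).eval y * w y / (y - t j)
  set V := ∫ y : ℝ, (P k).eval y * w y / (y - t j)
  set a := (P (k + 1)).eval (t j)
  set b := (P k).eval (t j)
  have hr_sub : γ j / h k * A - γ j = γ j / h k * (a * V) := by
    rw [hcross₂]
    field_simp
    ring
  calc (γ j / h k * A) ^ 2 - γ j * (γ j / h k * A)
      = (γ j / h k * A) * (γ j / h k * A - γ j) := by ring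
    _ = (γ j / h k * (b * U)) * (γ j / h k * (a * V)) := by rw [hr_sub, hcross₁]
    _ = _ := by field_simp
end

section
/- (Proposition 4.2: Toda equations.) For every t ∈ U: δβ_n(t) = 2·β_n(t)·(α_{n−1}(t) − α_n(t)) for every n ≥ 1 (equivalently δ ln β_n = 2(α_{n−1} − α_n)), and δα_n(t) = 1 + 2·(β_n(t) − β_{n+1}(t)) for every n ≥ 0, where δ = Σ_{k=1}^N ∂/∂t_k. -/
open MeasureTheory Polynomial

noncomputable def pd {N : ℕ} (j : Fin N) (f : (Fin N → ℝ) → ℝ) (x : Fin N → ℝ) : ℝ :=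
  deriv (fun s => f (Function.update x j s)) (x j)

namespace Toda

section Orthogonality

variable {L : ℝ[X] →ₗ[ℝ] ℝ} {P : ℕ → ℝ[X]}

/-- A polynomial of degree less than `n` is orthogonal to the `n`-th orthogonal polynomial. -/
lemma map_mul_eq_zero (hmonic : ∀ n, (P n).Monic) (hdeg : ∀ n, (P n).natDegree = n)
    (horth : ∀ m n, m ≠ n → L (P m * P n) = 0) {n : ℕ} {q : ℝ[X]}
    (hq : ∀ k, n ≤ k → q.coeff k = 0) : L (q * P n) = 0 := by
  suffices H : ∀ m ≤ n, ∀ q : ℝ[X], (∀ k, m ≤ k → q.coeff k = 0) → L (q * P n) = 0 from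
    H n le_rfl q hq
  intro m
  induction m with
  | zero =>
    intro _ q hq
    have : q = 0 := by ext k; simpa using hq k (Nat.zero_le k)
    simp [this]
  | succ m ih =>
    intro hm q hq
    have hlead : (P m).coeff m = 1 := by
      have := (hmonic m).coeff_natDegree
      rwa [hdeg m] at this
    have hrest := ih (by omega) (q - q.coeff m • P m) fun k hk => by
      rcases hk.eq_or_lt with rfl | hk
      · simp [hlead]
      · rw [coeff_sub, coeff_smul, hq k hk,
          coeff_eq_zero_of_natDegree_lt (p := P m) (by rwa [hdeg m])]
        simp
    rw [sub_mul, smul_mul_assoc, map_sub, map_smul, horth m n (by omega)] at hrest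
    simpa using hrest

/-- Pairing a polynomial of degree at most `n` with the `n`-th monic orthogonal polynomial
picks out its coefficient of degree `n`. -/
lemma map_mul_eq_coeff_mul (hmonic : ∀ n, (P n).Monic) (hdeg : ∀ n, (P n).natDegree = n)
    (horth : ∀ m n, m ≠ n → L (P m * P n) = 0) {n : ℕ} {q : ℝ[X]}
    (hq : ∀ k, n < k → q.coeff k = 0) : L (q * P n) = q.coeff n * L (P n * P n) := by
  have hlead : (P n).coeff n = 1 := by
    have := (hmonic n).coeff_natDegree
    rwa [hdeg n] at this
  have hrest := map_mul_eq_zero hmonic hdeg horth (n := n) (q := q - q.coeff n • P n)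
    fun k hk => by
      rcases hk.eq_or_lt with rfl | hk
      · simp [hlead]
      · rw [coeff_sub, coeff_smul, hq k hk,
          coeff_eq_zero_of_natDegree_lt (p := P n) (by rwa [hdeg n])]
        simp
  rw [sub_mul, smul_mul_assoc, map_sub, map_smul, smul_eq_mul] at hrest
  linarith

/-- The diagonal recurrence coefficient as a difference of subleading coefficients. -/
lemma map_X_mul_self (hmonic : ∀ n, (P n).Monic) (hdeg : ∀ n, (P n).natDegree = n)
    (horth : ∀ m n, m ≠ n → L (P m * P n) = 0) (n : ℕ) :
    L (X * P n * P n) = ((X * P n).coeff n - (P (n + 1)).coeff n) * L (P n * P n) := by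
  have hlead (n : ℕ) : (P n).coeff n = 1 := by
    have := (hmonic n).coeff_natDegree
    rwa [hdeg n] at this
  have hrest := map_mul_eq_coeff_mul hmonic hdeg horth (n := n) (q := X * P n - P (n + 1))
    fun k hk => by
      obtain ⟨k, rfl⟩ : ∃ l, k = l + 1 := ⟨k - 1, by omega⟩
      rw [coeff_sub, coeff_X_mul]
      rcases (Nat.lt_succ_iff.1 hk).eq_or_lt with rfl | hk
      · simp [hlead]
      · rw [coeff_eq_zero_of_natDegree_lt (by rwa [hdeg n]),
          coeff_eq_zero_of_natDegree_lt (by rw [hdeg (n + 1)]; omega), sub_zero]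
  rw [sub_mul, map_sub, horth (n + 1) n (by omega), sub_zero, coeff_sub] at hrest
  exact hrest

lemma map_X_mul_succ (hmonic : ∀ n, (P n).Monic) (hdeg : ∀ n, (P n).natDegree = n)
    (horth : ∀ m n, m ≠ n → L (P m * P n) = 0) (n : ℕ) :
    L (X * P n * P (n + 1)) = L (P (n + 1) * P (n + 1)) := by
  have hlead : (P n).coeff n = 1 := by
    have := (hmonic n).coeff_natDegree
    rwa [hdeg n] at this
  rw [map_mul_eq_coeff_mul hmonic hdeg horth (n := n + 1), coeff_X_mul, hlead, one_mul]
  intro k hk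
  obtain ⟨k, rfl⟩ : ∃ l, k = l + 1 := ⟨k - 1, by omega⟩
  rw [coeff_X_mul, coeff_eq_zero_of_natDegree_lt (by rw [hdeg n]; omega)]

end Orthogonality

section Deformation

/-- Product rule for coefficientwise derivatives of polynomials. -/
lemma hasDerivAt_coeff_mul {A B : ℝ → ℝ[X]} {A' B' : ℝ[X]} {s : ℝ}
    (hA : ∀ k, HasDerivAt (fun t => (A t).coeff k) (A'.coeff k) s)
    (hB : ∀ k, HasDerivAt (fun t => (B t).coeff k) (B'.coeff k) s) (k : ℕ) :
    HasDerivAt (fun t => (A t * B t).coeff k) ((A' * B s + A s * B').coeff k) s := by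
  simp only [coeff_mul, coeff_add, ← Finset.sum_add_distrib]
  exact HasDerivAt.fun_sum fun i _ => (hA i.1).mul (hB i.2)

/-- Product rule for the value of a varying linear functional at a varying polynomial of
bounded degree. -/
lemma hasDerivAt_map {L : ℝ → ℝ[X] →ₗ[ℝ] ℝ} {D : ℝ[X] →ₗ[ℝ] ℝ} {A : ℝ → ℝ[X]} {A' : ℝ[X]}
    {s : ℝ} {d : ℕ} (hL : ∀ k, HasDerivAt (fun t => L t (X ^ k)) (D (X ^ k)) s)
    (hA : ∀ k, HasDerivAt (fun t => (A t).coeff k) (A'.coeff k) s)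
    (hd : ∀ᶠ t in nhds s, (A t).natDegree < d) :
    HasDerivAt (fun t => L t (A t)) (L s A' + D (A s)) s := by
  have expand (M : ℝ[X] →ₗ[ℝ] ℝ) (q : ℝ[X]) (hq : ∀ k, d ≤ k → q.coeff k = 0) :
      M q = ∑ k ∈ Finset.range d, q.coeff k * M (X ^ k) := by
    have hsum : q = ∑ k ∈ Finset.range d, q.coeff k • X ^ k := by
      ext j
      simp only [finsetSum_coeff, coeff_smul, coeff_X_pow, smul_eq_mul, mul_ite, mul_one,
        mul_zero, Finset.sum_ite_eq, Finset.mem_range]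
      split_ifs with hj
      · rfl
      · exact hq j (not_lt.1 hj)
    conv_lhs => rw [hsum]
    simp
  have hA' (k : ℕ) (hk : d ≤ k) : A'.coeff k = 0 :=
    (hA k).unique <| (hasDerivAt_const s (0 : ℝ)).congr_of_eventuallyEq <| by
      filter_upwards [hd] with t ht
      exact coeff_eq_zero_of_natDegree_lt (ht.trans_le hk)
  have hs (k : ℕ) (hk : d ≤ k) : (A s).coeff k = 0 :=
    coeff_eq_zero_of_natDegree_lt (hd.self_of_nhds.trans_le hk)
  rw [expand (L s) A' hA', expand D (A s) hs, ← Finset.sum_add_distrib]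
  refine (HasDerivAt.fun_sum (u := Finset.range d) fun k _ =>
    (hA k).mul (hL k)).congr_of_eventuallyEq ?_
  filter_upwards [hd] with t ht
  exact expand (L t) (A t) fun k hk => coeff_eq_zero_of_natDegree_lt (ht.trans_le hk)

variable {L : ℝ → ℝ[X] →ₗ[ℝ] ℝ} {P : ℕ → ℝ → ℝ[X]}

lemma exists_coeff_hasDerivAt (hmonic : ∀ᶠ s in nhds 0, ∀ n, (P n s).Monic)
    (hdeg : ∀ᶠ s in nhds 0, ∀ n, (P n s).natDegree = n)
    (hdiff : ∀ n k, DifferentiableAt ℝ (fun s => (P n s).coeff k) 0) (n : ℕ) :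
    ∃ q : ℝ[X], (∀ k, HasDerivAt (fun s => (P n s).coeff k) (q.coeff k) 0) ∧
      ∀ k, n ≤ k → q.coeff k = 0 := by
  have hcoeff (k : ℕ) : (∑ i ∈ Finset.range n,
      monomial i (deriv (fun s => (P n s).coeff i) 0)).coeff k =
      if k < n then deriv (fun s => (P n s).coeff k) 0 else 0 := by
    simp [coeff_monomial]
  refine ⟨_, fun k => ?_, fun k hk => by rw [hcoeff, if_neg (not_lt.2 hk)]⟩
  rw [hcoeff]
  split_ifs with hk
  · exact (hdiff n k).hasDerivAt
  · refine (hasDerivAt_const (0 : ℝ) (if k = n then (1 : ℝ) else 0)).congr_of_eventuallyEq ?_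
    filter_upwards [hmonic, hdeg] with s hm hd
    split_ifs with hkn
    · subst hkn
      have := (hm k).coeff_natDegree
      rwa [hd k] at this
    · exact coeff_eq_zero_of_natDegree_lt (by rw [hd n]; omega)

/-- Norms of orthogonal polynomials along a flow `L' = L ∘ d/dX - 2 L ∘ X`. -/
lemma hasDerivAt_norm (hmonic : ∀ᶠ s in nhds 0, ∀ n, (P n s).Monic)
    (hdeg : ∀ᶠ s in nhds 0, ∀ n, (P n s).natDegree = n)
    (horth : ∀ᶠ s in nhds 0, ∀ m n, m ≠ n → L s (P m s * P n s) = 0)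
    (hdiff : ∀ n k, DifferentiableAt ℝ (fun s => (P n s).coeff k) 0)
    (hL : ∀ k : ℕ, HasDerivAt (fun s => L s (X ^ k))
      (L 0 (derivative (X ^ k)) - 2 * L 0 (X * X ^ k)) 0) (n : ℕ) :
    HasDerivAt (fun s => L s (P n s * P n s)) (-2 * L 0 (X * P n 0 * P n 0)) 0 := by
  obtain ⟨q, hq, hqn⟩ := exists_coeff_hasDerivAt hmonic hdeg hdiff n
  have hm := hmonic.self_of_nhds
  have hd := hdeg.self_of_nhds
  have ho := horth.self_of_nhds
  have key := hasDerivAt_map (L := L) (d := n + n + 1)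
    (D := L 0 ∘ₗ derivative - (2 : ℝ) • L 0 ∘ₗ LinearMap.mulLeft ℝ X)
    (hL := fun k => by simpa using hL k) (hA := hasDerivAt_coeff_mul hq hq)
    (by
      filter_upwards [hdeg] with s hd
      exact Nat.lt_succ_of_le (natDegree_mul_le.trans_eq (by rw [hd n])))
  have hder (k : ℕ) (hk : n ≤ k) : (derivative (P n 0)).coeff k = 0 := by
    rw [coeff_derivative, coeff_eq_zero_of_natDegree_lt (by rw [hd n]; omega), zero_mul]
  have h1 := map_mul_eq_zero hm hd ho hqn
  have h2 := map_mul_eq_zero hm hd ho hder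
  convert key using 1
  simp only [LinearMap.sub_apply, LinearMap.smul_apply, LinearMap.comp_apply,
    LinearMap.mulLeft_apply, derivative_mul, map_add, smul_eq_mul]
  rw [mul_comm (P n 0) q, mul_comm (P n 0) (derivative _), h1, h2, mul_assoc]
  ring

/-- Subleading coefficients of orthogonal polynomials along a flow
`L' = L ∘ d/dX - 2 L ∘ X`. -/
lemma hasDerivAt_subleading (hmonic : ∀ᶠ s in nhds 0, ∀ n, (P n s).Monic)
    (hdeg : ∀ᶠ s in nhds 0, ∀ n, (P n s).natDegree = n)
    (horth : ∀ᶠ s in nhds 0, ∀ m n, m ≠ n → L s (P m s * P n s) = 0)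
    (hpos : ∀ n, 0 < L 0 (P n 0 * P n 0))
    (hdiff : ∀ n k, DifferentiableAt ℝ (fun s => (P n s).coeff k) 0)
    (hL : ∀ k : ℕ, HasDerivAt (fun s => L s (X ^ k))
      (L 0 (derivative (X ^ k)) - 2 * L 0 (X * X ^ k)) 0) (n : ℕ) :
    HasDerivAt (fun s => (P (n + 1) s).coeff n)
      (2 * (L 0 (P (n + 1) 0 * P (n + 1) 0) / L 0 (P n 0 * P n 0)) - (n + 1)) 0 := by
  obtain ⟨q, hq, hqn⟩ := exists_coeff_hasDerivAt hmonic hdeg hdiff (n + 1)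
  obtain ⟨r, hr, hrn⟩ := exists_coeff_hasDerivAt hmonic hdeg hdiff n
  have hm := hmonic.self_of_nhds
  have hd := hdeg.self_of_nhds
  have ho := horth.self_of_nhds
  have key := hasDerivAt_map (L := L) (d := n + 1 + n + 1)
    (D := L 0 ∘ₗ derivative - (2 : ℝ) • L 0 ∘ₗ LinearMap.mulLeft ℝ X)
    (hL := fun k => by simpa using hL k) (hA := hasDerivAt_coeff_mul hq hr)
    (by
      filter_upwards [hdeg] with s hd
      exact Nat.lt_succ_of_le (natDegree_mul_le.trans_eq (by rw [hd n, hd (n + 1)])))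
  have hzero := key.unique <| (hasDerivAt_const (0 : ℝ) (0 : ℝ)).congr_of_eventuallyEq <| by
    filter_upwards [horth] with s ho
    exact ho (n + 1) n (by omega)
  have h1 := map_mul_eq_coeff_mul hm hd ho (n := n) (q := q) fun k hk => hqn k hk
  have h2 := map_mul_eq_zero hm hd ho (n := n + 1) (q := r) fun k hk => hrn k (by omega)
  have h3 := map_mul_eq_coeff_mul hm hd ho (n := n) (q := derivative (P (n + 1) 0))
    fun k hk => by
      rw [coeff_derivative, coeff_eq_zero_of_natDegree_lt (by rw [hd (n + 1)]; omega), zero_mul]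
  have h4 := map_mul_eq_zero hm hd ho (n := n + 1) (q := derivative (P n 0)) fun k hk => by
    rw [coeff_derivative, coeff_eq_zero_of_natDegree_lt (by rw [hd n]; omega), zero_mul]
  have h5 := map_X_mul_succ hm hd ho n
  have hlead : (P (n + 1) 0).coeff (n + 1) = 1 := by
    have := (hm (n + 1)).coeff_natDegree
    rwa [hd (n + 1)] at this
  rw [coeff_derivative, hlead, one_mul] at h3
  simp only [LinearMap.sub_apply, LinearMap.smul_apply, LinearMap.comp_apply,
    LinearMap.mulLeft_apply, derivative_mul, map_add, smul_eq_mul] at hzero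
  rw [mul_comm (P (n + 1) 0) r, mul_comm (P (n + 1) 0) (derivative _), h1, h2, h3, h4,
    mul_comm (P (n + 1) 0) (P n 0), ← mul_assoc X, h5] at hzero
  convert hq n using 1
  have := (hpos n).ne'
  field_simp
  linarith

end Deformation

section Weight

open Real

variable {N : ℕ}

/-- The Gaussian weight with algebraic zeros of order `γ j` at `x j`. -/
noncomputable def weight (γ x : Fin N → ℝ) (y : ℝ) : ℝ :=
  exp (-y ^ 2) * ∏ j, |y - x j| ^ γ j

lemma weight_nonneg (γ x : Fin N → ℝ) (y : ℝ) : 0 ≤ weight γ x y := by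
  unfold weight
  positivity

lemma continuous_weight {γ : Fin N → ℝ} (hγ : ∀ j, 0 < γ j) (x : Fin N → ℝ) :
    Continuous (weight γ x) := by
  unfold weight
  refine (by fun_prop : Continuous fun y : ℝ => exp (-y ^ 2)).mul
    (continuous_finsetProd _ fun j _ => ?_)
  exact (by fun_prop : Continuous fun y : ℝ => |y - x j|).rpow_const fun _ => .inr (hγ j).le

lemma weight_translate (γ x : Fin N → ℝ) (s u : ℝ) :
    weight γ (fun j => x j + s) (u + s) = exp (-(2 * s * u + s ^ 2)) * weight γ x u := by
  simp only [weight, add_sub_add_right_eq_sub]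
  rw [← mul_assoc, ← exp_add]
  ring_nf

lemma integrable_exp_mul_weight {γ : Fin N → ℝ} (hγ : ∀ j, 0 < γ j) (x : Fin N → ℝ) (c : ℝ) :
    Integrable fun y => exp (c * |y|) * weight γ x y := by
  set a : ℝ := c + ∑ j, γ j
  set b : ℝ := ∑ j, |x j| * γ j
  have hg : Integrable fun y : ℝ => exp (b + a ^ 2 / 2) * exp (-(1 / 2) * y ^ 2) :=
    (integrable_exp_neg_mul_sq (by norm_num)).const_mul _
  refine hg.mono' ((by fun_prop : Continuous fun y : ℝ => exp (c * |y|)).mul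
    (continuous_weight hγ x)).aestronglyMeasurable (.of_forall fun y => ?_)
  rw [norm_of_nonneg (mul_nonneg (exp_pos _).le (weight_nonneg γ x y))]
  have hprod : ∏ j, |y - x j| ^ γ j ≤ exp (∑ j, (|y| + |x j|) * γ j) := by
    rw [exp_sum]
    refine Finset.prod_le_prod (fun j _ => by positivity) fun j _ => ?_
    rw [exp_mul]
    refine rpow_le_rpow (abs_nonneg _) ?_ (hγ j).le
    linarith [abs_sub y (x j), add_one_le_exp (|y| + |x j|)]
  have hsum : ∑ j, (|y| + |x j|) * γ j = |y| * ∑ j, γ j + b := by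
    simp only [add_mul, Finset.sum_add_distrib, ← Finset.mul_sum, b]
  calc exp (c * |y|) * weight γ x y
      ≤ exp (c * |y|) * (exp (-y ^ 2) * exp (∑ j, (|y| + |x j|) * γ j)) := by
        unfold weight; gcongr
    _ = exp (c * |y| + (-y ^ 2 + (|y| * ∑ j, γ j + b))) := by
        rw [hsum, ← exp_add (-y ^ 2), ← exp_add]
    _ ≤ exp (b + a ^ 2 / 2 + -(1 / 2) * y ^ 2) := by
        refine exp_le_exp.2 ?_
        have h1 : c * |y| + |y| * ∑ j, γ j = a * |y| := by simp only [a]; ring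
        nlinarith [sq_nonneg (a - |y|), sq_abs y]
    _ = _ := exp_add _ _

lemma integrable_eval_mul_weight {γ : Fin N → ℝ} (hγ : ∀ j, 0 < γ j) (x : Fin N → ℝ)
    (q : ℝ[X]) : Integrable fun y => q.eval y * weight γ x y := by
  induction q using Polynomial.induction_on' with
  | add p q hp hq => simp only [eval_add, add_mul]; exact hp.add hq
  | monomial k a =>
    simp only [eval_monomial, mul_assoc]
    refine Integrable.const_mul ?_ a
    refine (integrable_exp_mul_weight hγ x k).mono'
      ((continuous_pow k).mul (continuous_weight hγ x)).aestronglyMeasurable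
      (.of_forall fun y => ?_)
    rw [norm_mul, norm_of_nonneg (weight_nonneg γ x y), norm_pow, norm_eq_abs, exp_nat_mul]
    have := weight_nonneg γ x y
    gcongr
    linarith [add_one_le_exp |y|]

/-- Integration of polynomials against the weight. -/
noncomputable def weightFunctional {γ : Fin N → ℝ} (hγ : ∀ j, 0 < γ j) (x : Fin N → ℝ) :
    ℝ[X] →ₗ[ℝ] ℝ where
  toFun q := ∫ y, q.eval y * weight γ x y
  map_add' p q := by
    simp only [eval_add, add_mul]
    exact integral_add (integrable_eval_mul_weight hγ x p) (integrable_eval_mul_weight hγ x q)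
  map_smul' a q := by
    simp only [eval_smul, smul_eq_mul, mul_assoc, RingHom.id_apply]
    exact integral_const_mul _ _

lemma weightFunctional_apply {γ : Fin N → ℝ} (hγ : ∀ j, 0 < γ j) (x : Fin N → ℝ) (q : ℝ[X]) :
    weightFunctional hγ x q = ∫ y, q.eval y * weight γ x y := rfl

/-- Derivative of the moments when all zeros of the weight are translated simultaneously. -/
lemma hasDerivAt_weightFunctional_pow {γ : Fin N → ℝ} (hγ : ∀ j, 0 < γ j) (x : Fin N → ℝ)
    (k : ℕ) :
    HasDerivAt (fun s => weightFunctional hγ (fun j => x j + s) (X ^ k))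
      (weightFunctional hγ x (derivative (X ^ k)) - 2 * weightFunctional hγ x (X * X ^ k)) 0 := by
  let F (s u : ℝ) : ℝ := (u + s) ^ k * (exp (-(2 * s * u + s ^ 2)) * weight γ x u)
  let F' (s u : ℝ) : ℝ := (k * (u + s) ^ (k - 1) - 2 * (u + s) ^ (k + 1)) *
    (exp (-(2 * s * u + s ^ 2)) * weight γ x u)
  have hF : (fun s => weightFunctional hγ (fun j => x j + s) (X ^ k)) =
      fun s => ∫ u, F s u := by
    funext s
    rw [weightFunctional_apply, ← integral_add_right_eq_self _ s]
    simp only [weight_translate, eval_pow, eval_X, F]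
  have hF0 : weightFunctional hγ x (derivative (X ^ k)) -
      2 * weightFunctional hγ x (X * X ^ k) = ∫ u, F' 0 u := by
    rw [← smul_eq_mul, ← map_smul, ← map_sub, weightFunctional_apply]
    congr 1
    funext u
    simp only [F', derivative_X_pow, eval_sub, eval_mul, eval_smul, eval_C, eval_pow, eval_X,
      smul_eq_mul, add_zero, mul_zero, zero_mul, neg_zero, exp_zero, ne_eq, OfNat.ofNat_ne_zero,
      not_false_eq_true, zero_pow]
    ring
  have hcw := continuous_weight hγ x
  rw [hF, hF0]
  refine (hasDerivAt_integral_of_dominated_loc_of_deriv_le (F := F) (F' := F')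
    (bound := fun u => (k + 2) * (exp ((k + 3 : ℕ) * |u|) * weight γ x u))
    (Metric.ball_mem_nhds 0 one_pos) (.of_forall fun s => ?_) ?_ ?_ ?_ ?_ ?_).2
  · exact (by fun_prop : Continuous (F s)).aestronglyMeasurable
  · simpa [F] using integrable_eval_mul_weight hγ x (X ^ k)
  · exact (by fun_prop : Continuous (F' 0)).aestronglyMeasurable
  · refine .of_forall fun u s hs => ?_
    have hs1 : |s| < 1 := by simpa using hs
    have hw := weight_nonneg γ x u
    have hE : |u| + 1 ≤ exp |u| := add_one_le_exp |u|
    have hE1 : 1 ≤ exp |u| := one_le_exp (abs_nonneg u)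
    have hus : |u + s| ≤ exp |u| := by linarith [abs_add_le u s]
    have hexp : exp (-(2 * s * u + s ^ 2)) ≤ exp |u| ^ 2 := by
      rw [← exp_nat_mul]
      refine exp_le_exp.2 ?_
      have : |s * u| ≤ |u| := by
        rw [abs_mul]; nlinarith [abs_nonneg u]
      push_cast
      nlinarith [neg_abs_le (s * u), sq_nonneg s]
    have hpoly : |k * (u + s) ^ (k - 1) - 2 * (u + s) ^ (k + 1)| ≤
        (k + 2) * exp |u| ^ (k + 1) := by
      calc _ ≤ |k * (u + s) ^ (k - 1)| + |2 * (u + s) ^ (k + 1)| := abs_sub _ _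
        _ = k * |u + s| ^ (k - 1) + 2 * |u + s| ^ (k + 1) := by simp [abs_mul, abs_pow]
        _ ≤ k * exp |u| ^ (k - 1) + 2 * exp |u| ^ (k + 1) := by gcongr
        _ ≤ k * exp |u| ^ (k + 1) + 2 * exp |u| ^ (k + 1) := by
          gcongr
          omega
        _ = _ := by ring
    rw [norm_mul, norm_eq_abs, norm_of_nonneg (mul_nonneg (exp_pos _).le hw), exp_nat_mul]
    calc _ ≤ (k + 2) * exp |u| ^ (k + 1) * (exp |u| ^ 2 * weight γ x u) := by gcongr
      _ = _ := by ring
  · exact (integrable_exp_mul_weight hγ x _).const_mul _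
  · refine .of_forall fun u s _ => ?_
    have h1 : HasDerivAt (fun s => (u + s) ^ k) (k * (u + s) ^ (k - 1) * 1) s :=
      ((hasDerivAt_id s).const_add u).pow k
    have h2 : HasDerivAt (fun s => -(2 * s * u + s ^ 2)) (-(2 * u + 2 * s)) s := by
      refine ((((hasDerivAt_id s).const_mul 2).mul_const u).fun_add
        (hasDerivAt_pow 2 s)).fun_neg.congr_deriv ?_
      simp
    refine (h1.fun_mul (h2.exp.mul_const (weight γ x u))).congr_deriv ?_
    simp only [F']
    ring

end Weight

/-- The sum of all partial derivatives is the derivative along the diagonal. -/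
lemma sum_pd_eq {N : ℕ} {f : (Fin N → ℝ) → ℝ} {x : Fin N → ℝ} {d : ℝ}
    (hf : DifferentiableAt ℝ f x) (hd : HasDerivAt (fun s => f fun j => x j + s) d 0) :
    ∑ k, pd k f x = d := by
  have hpd (k : Fin N) : pd k f x = fderiv ℝ f x (Pi.single k 1) := by
    have hf' : HasFDerivAt f (fderiv ℝ f x) (Function.update x k (x k)) := by
      rw [Function.update_eq_self]
      exact hf.hasFDerivAt
    exact (hf'.comp_hasDerivAt (x k) (hasDerivAt_update x k (x k))).deriv
  have hdiag : HasDerivAt (fun s => f fun j => x j + s) (fderiv ℝ f x fun _ => 1) 0 := by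
    have hf' : HasFDerivAt f (fderiv ℝ f x) (fun j => x j + (0 : ℝ)) := by
      simpa using hf.hasFDerivAt
    exact hf'.comp_hasDerivAt (0 : ℝ)
      (hasDerivAt_pi.2 fun j => (hasDerivAt_id (0 : ℝ)).const_add (x j))
  rw [hd.unique hdiag, Finset.sum_congr rfl fun k _ => hpd k, ← map_sum,
    Finset.univ_sum_single (fun _ : Fin N => (1 : ℝ))]

end Toda

theorem toda_equations
    (N : ℕ) (hN : 1 ≤ N) (γ : Fin N → ℝ) (hγ : ∀ j, 0 < γ j)
    (U : Set (Fin N → ℝ)) (hU : IsOpen U) (hUinj : ∀ x ∈ U, Function.Injective x)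
    (w : (Fin N → ℝ) → ℝ → ℝ)
    (hw : ∀ x ∈ U, ∀ y : ℝ, w x y = Real.exp (-y ^ 2) * ∏ j, |y - x j| ^ γ j)
    (P : ℕ → (Fin N → ℝ) → Polynomial ℝ)
    (hPmonic : ∀ n, ∀ x ∈ U, (P n x).Monic) (hPdeg : ∀ n, ∀ x ∈ U, (P n x).natDegree = n)
    (horth : ∀ m n, m ≠ n → ∀ x ∈ U, ∫ y : ℝ, (P m x).eval y * (P n x).eval y * w x y = 0)
    (h : ℕ → (Fin N → ℝ) → ℝ)
    (hh : ∀ n, ∀ x ∈ U, h n x = ∫ y : ℝ, ((P n x).eval y) ^ 2 * w x y)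
    (hhpos : ∀ n, ∀ x ∈ U, 0 < h n x)
    (β : ℕ → (Fin N → ℝ) → ℝ) (hβ0 : ∀ x ∈ U, β 0 x = 0)
    (hβ : ∀ n, ∀ x ∈ U, β (n + 1) x = h (n + 1) x / h n x)
    (α : ℕ → (Fin N → ℝ) → ℝ)
    (hα : ∀ n, ∀ x ∈ U, α n x = (∫ y : ℝ, y * ((P n x).eval y) ^ 2 * w x y) / h n x)
    (p : ℕ → (Fin N → ℝ) → ℝ) (hp0 : ∀ x ∈ U, p 0 x = 0)
    (hp : ∀ n, ∀ x ∈ U, p (n + 1) x = (P (n + 1) x).coeff n)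
    (R : ℕ → Fin N → (Fin N → ℝ) → ℝ)
    (hR : ∀ n j, ∀ x ∈ U, R n j x = γ j / h n x * ∫ y : ℝ, ((P n x).eval y) ^ 2 * w x y / (y - x j))
    (r : ℕ → Fin N → (Fin N → ℝ) → ℝ) (hr0 : ∀ j, ∀ x ∈ U, r 0 j x = 0)
    (hr : ∀ n j, ∀ x ∈ U, r (n + 1) j x = γ j / h n x * ∫ y : ℝ, (P (n + 1) x).eval y * (P n x).eval y * w x y / (y - x j))
    (hPC2 : ∀ m k, ContDiffOn ℝ 2 (fun x => (P m x).coeff k) U)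
    (hhC2 : ∀ m, ContDiffOn ℝ 2 (h m) U)
    (hαC2 : ∀ m, ContDiffOn ℝ 2 (α m) U)
    (hβC2 : ∀ m, ContDiffOn ℝ 2 (β m) U)
    (hpC2 : ∀ m, ContDiffOn ℝ 2 (p m) U)
    (hRC2 : ∀ m j, ContDiffOn ℝ 2 (R m j) U)
    (hrC2 : ∀ m j, ContDiffOn ℝ 2 (r m j) U)
    (x : Fin N → ℝ) (hx : x ∈ U) :
    (∀ n : ℕ, (∑ k, pd k (β (n + 1)) x) = 2 * β (n + 1) x * (α n x - α (n + 1) x)) ∧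
      (∀ n : ℕ, (∑ k, pd k (α n) x) = 1 + 2 * (β n x - β (n + 1) x)) := by
  have hx0 : (fun j => x j + (0 : ℝ)) = x := by simp
  have hcont : Continuous fun s : ℝ => fun j => x j + s := by fun_prop
  have hmem : ∀ᶠ s : ℝ in nhds 0, (fun j => x j + s) ∈ U :=
    hcont.continuousAt.eventually_mem (by rw [hx0]; exact hU.mem_nhds hx)
  have hdiffAt {f : (Fin N → ℝ) → ℝ} (hf : ContDiffOn ℝ 2 f U) : DifferentiableAt ℝ f x :=
    (hf.contDiffAt (hU.mem_nhds hx)).differentiableAt (by norm_num)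
  set L : ℝ → ℝ[X] →ₗ[ℝ] ℝ := fun s => Toda.weightFunctional hγ fun j => x j + s with hLdef
  set Q : ℕ → ℝ → ℝ[X] := fun n s => P n fun j => x j + s with hQdef
  have hint {t : Fin N → ℝ} (ht : t ∈ U) (q : ℝ[X]) :
      Toda.weightFunctional hγ t q = ∫ y, q.eval y * w t y := by
    simp only [Toda.weightFunctional_apply, Toda.weight, hw t ht]
  have hnorm {t : Fin N → ℝ} (ht : t ∈ U) (n : ℕ) :
      Toda.weightFunctional hγ t (P n t * P n t) = h n t := by
    simp only [hint ht, hh n t ht, eval_mul, sq]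
  have hort {t : Fin N → ℝ} (ht : t ∈ U) (m n : ℕ) (hmn : m ≠ n) :
      Toda.weightFunctional hγ t (P m t * P n t) = 0 := by
    simp only [hint ht, eval_mul, horth m n hmn t ht]
  have hXα {t : Fin N → ℝ} (ht : t ∈ U) (n : ℕ) :
      Toda.weightFunctional hγ t (X * P n t * P n t) = α n t * h n t := by
    rw [hα n t ht, div_mul_cancel₀ _ (hhpos n t ht).ne', hint ht]
    simp only [eval_mul, eval_X, sq, mul_assoc]
  have hαp {t : Fin N → ℝ} (ht : t ∈ U) (n : ℕ) :
      α n t = (X * P n t).coeff n - (P (n + 1) t).coeff n := by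
    have := Toda.map_X_mul_self (fun n => hPmonic n t ht) (fun n => hPdeg n t ht) (hort ht) n
    rw [hXα ht, hnorm ht] at this
    exact mul_right_cancel₀ (hhpos n t ht).ne' this
  have hmonic : ∀ᶠ s in nhds 0, ∀ n, (Q n s).Monic := by
    filter_upwards [hmem] with s hs n using hPmonic n _ hs
  have hdeg : ∀ᶠ s in nhds 0, ∀ n, (Q n s).natDegree = n := by
    filter_upwards [hmem] with s hs n using hPdeg n _ hs
  have hQorth : ∀ᶠ s in nhds 0, ∀ m n, m ≠ n → L s (Q m s * Q n s) = 0 := by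
    filter_upwards [hmem] with s hs using hort hs
  have hdiff (n k : ℕ) : DifferentiableAt ℝ (fun s => (Q n s).coeff k) 0 := by
    have h1 : DifferentiableAt ℝ (fun t => (P n t).coeff k) (fun j => x j + (0 : ℝ)) := by
      rw [hx0]; exact hdiffAt (hPC2 n k)
    exact h1.comp (0 : ℝ) (f := fun s : ℝ => fun j => x j + s) (by fun_prop)
  have hL0 : L 0 = Toda.weightFunctional hγ x := by simp only [hLdef, hx0]
  have hQ0 (n : ℕ) : Q n 0 = P n x := by simp only [hQdef, hx0]
  have hL (k : ℕ) : HasDerivAt (fun s => L s (X ^ k))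
      (L 0 (derivative (X ^ k)) - 2 * L 0 (X * X ^ k)) 0 := by
    rw [hL0]; exact Toda.hasDerivAt_weightFunctional_pow hγ x k
  have hdh (n : ℕ) : HasDerivAt (fun s => h n fun j => x j + s) (-2 * (α n x * h n x)) 0 := by
    have := Toda.hasDerivAt_norm hmonic hdeg hQorth hdiff hL n
    rw [hL0, hQ0, hXα hx] at this
    refine this.congr_of_eventuallyEq ?_
    filter_upwards [hmem] with s hs using (hnorm hs n).symm
  have hdp (n : ℕ) : HasDerivAt (fun s => (Q (n + 1) s).coeff n)
      (2 * β (n + 1) x - (n + 1)) 0 := by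
    have := Toda.hasDerivAt_subleading hmonic hdeg hQorth
      (fun n => by rw [hL0, hQ0, hnorm hx]; exact hhpos n x hx) hdiff hL n
    rwa [hL0, hQ0, hQ0, hnorm hx, hnorm hx, ← hβ n x hx] at this
  have hdp' (n : ℕ) : HasDerivAt (fun s => (X * Q n s).coeff n) (2 * β n x - n) 0 := by
    cases n with
    | zero => simpa [hβ0 x hx] using hasDerivAt_const (0 : ℝ) (0 : ℝ)
    | succ n => simpa only [coeff_X_mul, Nat.cast_succ] using hdp n
  refine ⟨fun n => Toda.sum_pd_eq (hdiffAt (hβC2 (n + 1))) ?_,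
    fun n => Toda.sum_pd_eq (hdiffAt (hαC2 n)) ?_⟩
  · have hne : h n (fun j => x j + (0 : ℝ)) ≠ 0 := by rw [hx0]; exact (hhpos n x hx).ne'
    have hquot := ((hdh (n + 1)).fun_div (hdh n) hne).congr_of_eventuallyEq
      (f₁ := fun s => β (n + 1) fun j => x j + s) <| by
        filter_upwards [hmem] with s hs using hβ n _ hs
    refine hquot.congr_deriv ?_
    rw [hx0, hβ n x hx]
    have := (hhpos n x hx).ne'
    field_simp
    ring
  · have hsub := ((hdp' n).fun_sub (hdp n)).congr_of_eventuallyEq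
      (f₁ := fun s => α n fun j => x j + s) <| by
        filter_upwards [hmem] with s hs using hαp hs n
    refine hsub.congr_deriv ?_
    ring
end
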